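/- Let α > 1 and let m ∈ L^{α,∞}(𝕋^d), i.e., there exists c > 0 with |{ξ ∈ (0,1)^d : |m(ξ)| ≥ s}| ≤ c/s^α for all s > 0. Then the Fourier multiplier operator T_m is bounded from ℓ^p(ℤ^d) to ℓ^q(ℤ^d) for every pair (p,q) with 1 < p ≤ 2 ≤ q < ∞ and 1/p − 1/q ≥ 1/α. -/

import Mathlib

open MeasureTheory Real Complex

/-- The open unit cube `(0,1)^d` in `ℝ^d`. -/
noncomputable def unitCube (d : ℕ) : Set (Fin d → ℝ) :=
  Set.univ.pi fun _ => Set.Ioo (0 : ℝ) 1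

/-- Discrete Fourier transform on `ℤ^d`: `F(f)(ξ) = ∑_{n ∈ ℤ^d} f(n) e^{2πi n·ξ}`. -/
noncomputable def dft (d : ℕ) (f : (Fin d → ℤ) → ℂ) (ξ : Fin d → ℝ) : ℂ :=
  ∑' n : Fin d → ℤ, f n * Complex.exp (2 * Real.pi * Complex.I * ∑ i, (n i : ℂ) * (ξ i : ℂ))

/-- The Fourier multiplier operator `T_m`, given by `T_m f = F⁻¹(m · F(f))`. -/
noncomputable def Tmult (d : ℕ) (m : (Fin d → ℝ) → ℂ) (f : (Fin d → ℤ) → ℂ)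
    (n : Fin d → ℤ) : ℂ :=
  ∫ ξ in unitCube d, m ξ * dft d f ξ *
    Complex.exp (-(2 * Real.pi * Complex.I) * ∑ i, (ξ i : ℂ) * (n i : ℂ))

/-- The `ℓ^p(ℤ^d)` norm, as the `L^p` norm with respect to counting measure. -/
noncomputable def lpNorm (d : ℕ) (f : (Fin d → ℤ) → ℂ) (p : ℝ) : ENNReal :=
  eLpNorm f (ENNReal.ofReal p) (Measure.count : Measure (Fin d → ℤ))

section DiscreteFourier

variable {d : ℕ}

/-- The character `ξ ↦ e^{2πi n·ξ}`. -/
noncomputable def expChar (n : Fin d → ℤ) (ξ : Fin d → ℝ) : ℂ :=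
  Complex.exp (2 * Real.pi * Complex.I * ∑ i, (n i : ℂ) * (ξ i : ℂ))

lemma dft_eq_tsum_expChar (f : (Fin d → ℤ) → ℂ) (ξ : Fin d → ℝ) :
    dft d f ξ = ∑' n, f n * expChar n ξ := rfl

lemma norm_expChar (n : Fin d → ℤ) (ξ : Fin d → ℝ) : ‖expChar n ξ‖ = 1 := by
  have : (2 * Real.pi * Complex.I * ∑ i, (n i : ℂ) * (ξ i : ℂ) : ℂ)
      = ((2 * Real.pi * ∑ i, (n i : ℝ) * ξ i : ℝ) : ℂ) * Complex.I := by
    push_cast; ring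
  rw [expChar, this, Complex.norm_exp_ofReal_mul_I]

lemma enorm_expChar (n : Fin d → ℤ) (ξ : Fin d → ℝ) : ‖expChar n ξ‖ₑ = 1 := by
  rw [← ofReal_norm, norm_expChar, ENNReal.ofReal_one]

@[fun_prop]
lemma continuous_expChar (n : Fin d → ℤ) : Continuous (expChar n) := by
  unfold expChar; fun_prop

lemma star_expChar (n : Fin d → ℤ) (ξ : Fin d → ℝ) :
    starRingEnd ℂ (expChar n ξ)
      = Complex.exp (-(2 * Real.pi * Complex.I) * ∑ i, (ξ i : ℂ) * (n i : ℂ)) := by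
  rw [expChar, ← Complex.exp_conj]
  simp [mul_comm, Complex.conj_ofNat]

lemma expChar_mul_star (n k : Fin d → ℤ) (ξ : Fin d → ℝ) :
    expChar n ξ * starRingEnd ℂ (expChar k ξ) = expChar (n - k) ξ := by
  rw [star_expChar, expChar, expChar, ← Complex.exp_add]
  congr 1
  simp only [Pi.sub_apply, Int.cast_sub, sub_mul, Finset.sum_sub_distrib, mul_sub]
  simp only [mul_comm ((ξ _ : ℂ))]
  ring

instance isProbabilityMeasure_unitCube :
    IsProbabilityMeasure ((volume : Measure (Fin d → ℝ)).restrict (unitCube d)) := by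
  constructor
  simp [unitCube, volume_pi, Measure.pi_pi]

lemma integral_exp_two_pi_Ioo (k : ℤ) :
    ∫ x in Set.Ioo (0 : ℝ) 1, Complex.exp (2 * Real.pi * Complex.I * ((k : ℂ) * (x : ℂ)))
      = if k = 0 then 1 else 0 := by
  split_ifs with hk
  · simp [hk]
  · have hc : (2 * Real.pi * Complex.I * k : ℂ) ≠ 0 := by
      simp [Real.pi_ne_zero, hk]
    rw [← integral_Ioc_eq_integral_Ioo, ← intervalIntegral.integral_of_le zero_le_one]
    simp only [← mul_assoc]
    rw [integral_exp_mul_complex hc]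
    have h1 : Complex.exp (2 * Real.pi * Complex.I * k) = 1 :=
      Complex.exp_eq_one_iff.2 ⟨k, by ring⟩
    simp [h1]

lemma integral_expChar (n : Fin d → ℤ) :
    ∫ ξ in unitCube d, expChar n ξ = if n = 0 then 1 else 0 := by
  have h (ξ : Fin d → ℝ) : expChar n ξ
      = ∏ i, Complex.exp (2 * Real.pi * Complex.I * ((n i : ℂ) * (ξ i : ℂ))) := by
    rw [expChar, Finset.mul_sum, Complex.exp_sum]
  simp_rw [h]
  rw [unitCube, volume_pi, Measure.restrict_pi_pi,
    integral_fintype_prod_eq_prod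
      (f := fun i (x : ℝ) => Complex.exp (2 * Real.pi * Complex.I * ((n i : ℂ) * (x : ℂ))))]
  simp_rw [integral_exp_two_pi_Ioo]
  split_ifs with hn
  · simp [hn]
  · obtain ⟨i, hi⟩ := Function.ne_iff.1 hn
    exact Finset.prod_eq_zero (Finset.mem_univ i) (by simpa using hi)

lemma summable_mul_expChar {f : (Fin d → ℤ) → ℂ} (hf : Summable fun n => ‖f n‖)
    (ξ : Fin d → ℝ) : Summable fun n => f n * expChar n ξ :=
  Summable.of_norm (by simpa [norm_expChar] using hf)

lemma continuous_dft {f : (Fin d → ℤ) → ℂ} (hf : Summable fun n => ‖f n‖) :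
    Continuous (dft d f) :=
  continuous_tsum (f := fun n ξ => f n * expChar n ξ) (fun n => by fun_prop) hf
    (fun n ξ => by simp [norm_expChar])

lemma enorm_dft_le (f : (Fin d → ℤ) → ℂ) (ξ : Fin d → ℝ) :
    ‖dft d f ξ‖ₑ ≤ ∑' n, ‖f n‖ₑ := by
  rw [dft_eq_tsum_expChar]
  refine enorm_tsum_le_tsum_enorm.trans_eq ?_
  simp [enorm_mul, enorm_expChar]

lemma dft_add {f g : (Fin d → ℤ) → ℂ} (hf : Summable fun n => ‖f n‖)
    (hg : Summable fun n => ‖g n‖) (ξ : Fin d → ℝ) :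
    dft d (f + g) ξ = dft d f ξ + dft d g ξ := by
  simp only [dft_eq_tsum_expChar, Pi.add_apply, add_mul]
  exact (summable_mul_expChar hf ξ).tsum_add (summable_mul_expChar hg ξ)

lemma dft_const_mul (c : ℂ) (f : (Fin d → ℤ) → ℂ) (ξ : Fin d → ℝ) :
    dft d (fun n => c * f n) ξ = c * dft d f ξ := by
  simp only [dft_eq_tsum_expChar, mul_assoc, tsum_mul_left]

/-- Parseval's identity for absolutely summable sequences. -/
lemma lintegral_enorm_dft_sq {f : (Fin d → ℤ) → ℂ} (hf : Summable fun n => ‖f n‖) :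
    ∫⁻ ξ in unitCube d, ‖dft d f ξ‖ₑ ^ 2 = ∑' n, ‖f n‖ₑ ^ 2 := by
  have hsum2 : Summable fun x : (Fin d → ℤ) × (Fin d → ℤ) => ‖f x.1 * starRingEnd ℂ (f x.2)‖ := by
    simpa using hf.mul_norm (g := fun n => starRingEnd ℂ (f n)) (by simpa using hf)
  have hsq (ξ : Fin d → ℝ) : ((‖dft d f ξ‖ ^ 2 : ℝ) : ℂ)
      = ∑' x : (Fin d → ℤ) × (Fin d → ℤ),
        f x.1 * starRingEnd ℂ (f x.2) * expChar (x.1 - x.2) ξ := by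
    have hconj : starRingEnd ℂ (dft d f ξ)
        = ∑' n, starRingEnd ℂ (f n * expChar n ξ) := by
      rw [dft_eq_tsum_expChar, Complex.conj_tsum]
    rw [Complex.ofReal_pow, ← Complex.mul_conj', hconj, dft_eq_tsum_expChar,
      tsum_mul_tsum_of_summable_norm (by simpa [norm_expChar] using hf)
        (by simpa [norm_expChar] using hf)]
    refine tsum_congr fun x => ?_
    rw [← expChar_mul_star, map_mul]
    ring
  have hInt : ((∫ ξ in unitCube d, ‖dft d f ξ‖ ^ 2 : ℝ) : ℂ) = ((∑' n, ‖f n‖ ^ 2 : ℝ) : ℂ) := by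
    rw [← integral_complex_ofReal]
    simp_rw [hsq]
    have hterm (x : (Fin d → ℤ) × (Fin d → ℤ)) :
        Integrable (fun ξ => f x.1 * starRingEnd ℂ (f x.2) * expChar (x.1 - x.2) ξ)
          (volume.restrict (unitCube d)) := by
      refine Integrable.const_mul ?_ _
      refine Integrable.of_bound (continuous_expChar _).aestronglyMeasurable 1 ?_
      exact Filter.Eventually.of_forall fun ξ => (norm_expChar _ ξ).le
    rw [← (hasSum_integral_of_summable_integral_norm hterm
      (by simpa [norm_expChar] using hsum2)).tsum_eq]
    simp_rw [integral_const_mul, integral_expChar, sub_eq_zero]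
    have hsum3 : Summable fun x : (Fin d → ℤ) × (Fin d → ℤ) =>
        f x.1 * starRingEnd ℂ (f x.2) * if x.1 = x.2 then 1 else 0 := by
      refine Summable.of_norm (hsum2.of_nonneg_of_le (fun _ => norm_nonneg _) fun x => ?_)
      split_ifs
      · simp
      · simp only [mul_zero, norm_zero]
        positivity
    rw [hsum3.tsum_prod, Complex.ofReal_tsum]
    refine tsum_congr fun n => ?_
    rw [tsum_eq_single n (fun k hk => by simp [hk.symm])]
    simp [Complex.mul_conj']
  have hf2 : Summable fun n => ‖f n‖ ^ 2 := by
    have := hf.mul_norm hf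
    simpa [Function.comp_def, pow_two] using this.comp_injective
      (i := fun n => (n, n)) (fun a b h => (Prod.ext_iff.1 h).1)
  have hbd (ξ : Fin d → ℝ) : ‖dft d f ξ‖ ≤ ∑' n, ‖f n‖ := by
    rw [dft_eq_tsum_expChar]
    refine (norm_tsum_le_tsum_norm (by simpa [norm_expChar] using hf)).trans_eq ?_
    simp [norm_expChar]
  have hi : Integrable (fun ξ => ‖dft d f ξ‖ ^ 2) (volume.restrict (unitCube d)) := by
    refine Integrable.of_bound ((continuous_dft hf).norm.pow 2).aestronglyMeasurable
      ((∑' n, ‖f n‖) ^ 2) (Filter.Eventually.of_forall fun ξ => ?_)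
    rw [norm_pow, norm_norm]
    gcongr
    exact hbd ξ
  have h3 := ofReal_integral_eq_lintegral_ofReal hi (Filter.Eventually.of_forall fun ξ => by positivity)
  rw [Complex.ofReal_injective hInt, ENNReal.ofReal_tsum_of_nonneg (fun _ => by positivity) hf2] at h3
  simpa [ENNReal.ofReal_pow, ofReal_norm] using h3.symm

end DiscreteFourier

section WeightedEstimate

variable {d : ℕ}

lemma enorm_add_sq_le (a b : ℂ) : ‖a + b‖ₑ ^ 2 ≤ 2 * ‖a‖ₑ ^ 2 + 2 * ‖b‖ₑ ^ 2 := by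
  have h : ‖a + b‖ ^ 2 ≤ 2 * ‖a‖ ^ 2 + 2 * ‖b‖ ^ 2 := by
    have := norm_add_le a b
    nlinarith [sq_nonneg (‖a‖ - ‖b‖), norm_nonneg (a + b), norm_nonneg a, norm_nonneg b]
  have h2 := ENNReal.ofReal_le_ofReal h
  rw [ENNReal.ofReal_add (by positivity) (by positivity), ENNReal.ofReal_mul (by norm_num),
    ENNReal.ofReal_mul (by norm_num)] at h2
  simpa [ENNReal.ofReal_pow, ofReal_norm] using h2

/-- `L²` bound on a set for the Fourier transform of a sum, using the trivial bound for the
first summand and Parseval for the second. -/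
lemma setLIntegral_enorm_dft_add_sq_le {g h : (Fin d → ℤ) → ℂ} (hg : Summable fun n => ‖g n‖)
    (hh : Summable fun n => ‖h n‖) {E : Set (Fin d → ℝ)} (hE : E ⊆ unitCube d) :
    ∫⁻ ξ in E, ‖dft d (g + h) ξ‖ₑ ^ 2
      ≤ 2 * (volume E * (∑' n, ‖g n‖ₑ) ^ 2) + 2 * ∑' n, ‖h n‖ₑ ^ 2 := by
  have hm1 : Measurable fun ξ => ‖dft d g ξ‖ₑ ^ 2 := ((continuous_dft hg).measurable.enorm.pow_const 2)
  have hm2 : Measurable fun ξ => ‖dft d h ξ‖ₑ ^ 2 := ((continuous_dft hh).measurable.enorm.pow_const 2)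
  calc ∫⁻ ξ in E, ‖dft d (g + h) ξ‖ₑ ^ 2
      ≤ ∫⁻ ξ in E, (2 * ‖dft d g ξ‖ₑ ^ 2 + 2 * ‖dft d h ξ‖ₑ ^ 2) := by
        refine lintegral_mono fun ξ => ?_
        rw [dft_add hg hh]
        exact enorm_add_sq_le _ _
    _ = 2 * (∫⁻ ξ in E, ‖dft d g ξ‖ₑ ^ 2) + 2 * ∫⁻ ξ in E, ‖dft d h ξ‖ₑ ^ 2 := by
        rw [lintegral_add_left (hm1.const_mul 2), lintegral_const_mul _ hm1,
          lintegral_const_mul _ hm2]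
    _ ≤ 2 * (∫⁻ _ in E, (∑' n, ‖g n‖ₑ) ^ 2) + 2 * ∫⁻ ξ in unitCube d, ‖dft d h ξ‖ₑ ^ 2 := by
        gcongr
        exact enorm_dft_le _ _
    _ = _ := by
        rw [lintegral_enorm_dft_sq hh, setLIntegral_const, mul_comm (volume E)]

lemma lintegral_ofReal_mul_rpow_Ioi {A β M : ℝ} (hA : 0 ≤ A) (hβ : 1 < β) (hM : 0 < M) :
    ∫⁻ s in Set.Ioi M, ENNReal.ofReal (A / s ^ β) = ENNReal.ofReal (A / (β - 1) * M ^ (1 - β)) := by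
  have hi := (integrableOn_Ioi_rpow_of_lt (a := -β) (by linarith) hM).const_mul A
  have h := ofReal_integral_eq_lintegral_ofReal hi (by
    filter_upwards [ae_restrict_mem measurableSet_Ioi] with s hs
    have : 0 < s := hM.trans hs
    simp only [Pi.zero_apply]
    positivity)
  rw [integral_const_mul, integral_Ioi_rpow_of_lt (by linarith) hM] at h
  calc ∫⁻ s in Set.Ioi M, ENNReal.ofReal (A / s ^ β)
      = ∫⁻ s in Set.Ioi M, ENNReal.ofReal (A * s ^ (-β)) := by
        refine setLIntegral_congr_fun measurableSet_Ioi fun s hs => ?_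
        have : 0 < s := hM.trans hs
        simp only [Real.rpow_neg this.le, div_eq_mul_inv]
    _ = _ := by
        rw [← h]
        congr 1
        have h1 : β - 1 ≠ 0 := by linarith
        have h2 : -β + 1 ≠ 0 := by linarith
        rw [show 1 - β = -β + 1 by ring]
        field_simp
        ring

/-- The contribution of a pair of values above the level-dependent threshold. -/
lemma lintegral_threshold_pair_le {A p x y : ℝ} (hA : 0 ≤ A) (hp : 1 < p) (hp2 : p < 2)
    (hx : 0 < x) (hy : 0 < y) :
    ∫⁻ s in Set.Ioi 0, ENNReal.ofReal (A / s ^ (p / (2 - p))) *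
        (if 1 < s * x ^ (2 - p) ∧ 1 < s * y ^ (2 - p) then 1 else 0)
      ≤ ENNReal.ofReal (A * (2 - p) / (2 * p - 2) * (x ^ (p - 1) * y ^ (p - 1))) := by
  have h2p : 0 < 2 - p := by linarith
  have hβ : 1 < p / (2 - p) := by rw [lt_div_iff₀ h2p]; linarith
  set M : ℝ := x ^ (-(2 - p) / 2) * y ^ (-(2 - p) / 2) with hM
  have hM0 : 0 < M := by positivity
  calc _ ≤ ∫⁻ s in Set.Ioi 0, (Set.Ioi M).indicator
          (fun s => ENNReal.ofReal (A / s ^ (p / (2 - p)))) s := by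
        refine setLIntegral_mono' measurableSet_Ioi fun s hs => ?_
        have hs0 : (0 : ℝ) < s := hs
        split_ifs with h
        · rw [Set.indicator_of_mem, mul_one]
          have h1 : 1 < (s * x ^ (2 - p)) * (s * y ^ (2 - p)) := one_lt_mul_of_le_of_lt h.1.le h.2
          have h2 : M ^ 2 * ((s * x ^ (2 - p)) * (s * y ^ (2 - p))) = s ^ 2 := by
            have ex : (x ^ (-(2 - p) / 2)) ^ 2 * x ^ (2 - p) = 1 := by
              rw [← Real.rpow_natCast, ← Real.rpow_mul hx.le, ← Real.rpow_add hx]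
              simp
            have ey : (y ^ (-(2 - p) / 2)) ^ 2 * y ^ (2 - p) = 1 := by
              rw [← Real.rpow_natCast, ← Real.rpow_mul hy.le, ← Real.rpow_add hy]
              simp
            linear_combination (s ^ 2 * (y ^ (-(2 - p) / 2)) ^ 2 * y ^ (2 - p)) * ex + s ^ 2 * ey
          have h3 : M ^ 2 < s ^ 2 := by
            rw [← h2]
            exact lt_mul_of_one_lt_right (by positivity) h1
          exact lt_of_pow_lt_pow_left₀ 2 hs0.le h3
        · simp
    _ ≤ ∫⁻ s, (Set.Ioi M).indicator (fun s => ENNReal.ofReal (A / s ^ (p / (2 - p)))) s :=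
        setLIntegral_le_lintegral _ _
    _ = ENNReal.ofReal (A / (p / (2 - p) - 1) * M ^ (1 - p / (2 - p))) := by
        rw [lintegral_indicator measurableSet_Ioi, lintegral_ofReal_mul_rpow_Ioi hA hβ hM0]
    _ = _ := by
        congr 2
        · have : 2 * p - 2 ≠ 0 := by linarith
          have : p / (2 - p) - 1 = (2 * p - 2) / (2 - p) := by field_simp; ring
          rw [this]
          field_simp
        · have e : -(2 - p) / 2 * (1 - p / (2 - p)) = p - 1 := by field_simp; ring
          rw [hM, Real.mul_rpow (by positivity) (by positivity), ← Real.rpow_mul hx.le,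
            ← Real.rpow_mul hy.le, e]

/-- The contribution of a value below the level-dependent threshold. -/
lemma lintegral_threshold_le {p x : ℝ} (hx : 0 < x) :
    ∫⁻ s in Set.Ioi 0, (if 1 < s * x ^ (2 - p) then 0 else ENNReal.ofReal x ^ 2)
      ≤ ENNReal.ofReal x ^ p := by
  calc _ ≤ ∫⁻ s, (Set.Ioc 0 (x ^ (p - 2))).indicator (fun _ => ENNReal.ofReal x ^ 2) s := by
        rw [← lintegral_indicator measurableSet_Ioi]
        refine lintegral_mono fun s => ?_
        by_cases hs : 0 < s
        · rw [Set.indicator_of_mem (show s ∈ Set.Ioi (0 : ℝ) from hs)]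
          split_ifs with h
          · simp
          · rw [Set.indicator_of_mem]
            refine ⟨hs, ?_⟩
            have e : x ^ (2 - p) * x ^ (p - 2) = 1 := by
              rw [← Real.rpow_add hx]; simp
            have : 0 < x ^ (p - 2) := by positivity
            calc s = s * x ^ (2 - p) * x ^ (p - 2) := by rw [mul_assoc, e, mul_one]
              _ ≤ 1 * x ^ (p - 2) := by gcongr; exact not_lt.1 h
              _ = _ := one_mul _
        · simp [hs]
    _ = ENNReal.ofReal x ^ 2 * ENNReal.ofReal (x ^ (p - 2)) := by
        rw [lintegral_indicator measurableSet_Ioc, setLIntegral_const, Real.volume_Ioc, sub_zero]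
    _ = _ := by
        rw [← ENNReal.ofReal_rpow_of_pos hx, ← ENNReal.rpow_natCast,
          ← ENNReal.rpow_add _ _ (by simpa using hx) (by simp)]
        simp

/-- Weighted `ℓ^p → L²` estimate for the Fourier transform, for normalised sequences. -/
lemma lintegral_weight_enorm_dft_sq_le_of_tsum_le_one {u : (Fin d → ℝ) → ℝ} (hu : Measurable u)
    (hu0 : ∀ ξ, 0 ≤ u ξ) {p A : ℝ} (hp : 1 < p) (hp2 : p < 2) (hA : 0 ≤ A)
    (hweak : ∀ s : ℝ, 0 < s →
      volume {ξ ∈ unitCube d | s ≤ u ξ} ≤ ENNReal.ofReal (A / s ^ (p / (2 - p))))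
    {f : (Fin d → ℤ) → ℂ} (hf : Summable fun n => ‖f n‖) (hf1 : ∑' n, ‖f n‖ₑ ^ p ≤ 1) :
    ∫⁻ ξ in unitCube d, ENNReal.ofReal (u ξ) * ‖dft d f ξ‖ₑ ^ 2
      ≤ 2 * ENNReal.ofReal (A * (2 - p) / (2 * p - 2)) + 2 := by
  classical
  have hcube : MeasurableSet (unitCube d) :=
    MeasurableSet.univ_pi fun _ => measurableSet_Ioo
  have hF : Measurable fun ξ => ‖dft d f ξ‖ₑ ^ 2 :=
    (continuous_dft hf).measurable.enorm.pow_const 2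
  set μ := (volume.restrict (unitCube d)).withDensity fun ξ => ‖dft d f ξ‖ₑ ^ 2 with hμ
  have hlayer : ∫⁻ ξ in unitCube d, ENNReal.ofReal (u ξ) * ‖dft d f ξ‖ₑ ^ 2
      = ∫⁻ s in Set.Ioi (0 : ℝ), μ {ξ | s ≤ u ξ} := by
    rw [← lintegral_eq_lintegral_meas_le μ (Filter.Eventually.of_forall hu0) hu.aemeasurable, hμ,
      lintegral_withDensity_eq_lintegral_mul _ hF hu.ennreal_ofReal]
    simp [mul_comm]
  have hlevel (s : ℝ) (hs : 0 < s) : μ {ξ | s ≤ u ξ}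
      ≤ 2 * (∑' n, ∑' k, ENNReal.ofReal (A / s ^ (p / (2 - p))) *
          (if 1 < s * ‖f n‖ ^ (2 - p) ∧ 1 < s * ‖f k‖ ^ (2 - p) then 1 else 0)
            * (‖f n‖ₑ * ‖f k‖ₑ))
        + 2 * ∑' n, (if 1 < s * ‖f n‖ ^ (2 - p) then 0 else ‖f n‖ₑ ^ 2) := by
    set g : (Fin d → ℤ) → ℂ := fun n => if 1 < s * ‖f n‖ ^ (2 - p) then f n else 0 with hg
    set h : (Fin d → ℤ) → ℂ := fun n => if 1 < s * ‖f n‖ ^ (2 - p) then 0 else f n with hh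
    have hgh : f = g + h := by
      ext n
      simp only [hg, hh, Pi.add_apply]
      split_ifs <;> simp
    have hgs : Summable fun n => ‖g n‖ := hf.of_nonneg_of_le (fun _ => norm_nonneg _) fun n => by
      simp only [hg]
      split_ifs <;> simp
    have hhs : Summable fun n => ‖h n‖ := hf.of_nonneg_of_le (fun _ => norm_nonneg _) fun n => by
      simp only [hh]
      split_ifs <;> simp
    have hms : MeasurableSet {ξ | s ≤ u ξ} := measurableSet_le measurable_const hu
    rw [hμ, withDensity_apply _ hms, Measure.restrict_restrict hms, hgh]
    refine (setLIntegral_enorm_dft_add_sq_le hgs hhs Set.inter_subset_right).trans ?_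
    rw [← hgh]
    gcongr ?_ + ?_
    · rw [Set.inter_comm]
      calc 2 * (volume (unitCube d ∩ {ξ | s ≤ u ξ}) * (∑' n, ‖g n‖ₑ) ^ 2)
          ≤ 2 * (ENNReal.ofReal (A / s ^ (p / (2 - p))) * (∑' n, ‖g n‖ₑ) ^ 2) := by
            gcongr
            exact hweak s hs
        _ = _ := by
            rw [pow_two, ← ENNReal.tsum_mul_right, ← ENNReal.tsum_mul_left]
            congr 1
            refine tsum_congr fun n => ?_
            rw [← ENNReal.tsum_mul_left, ← ENNReal.tsum_mul_left]
            refine tsum_congr fun k => ?_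
            simp only [hg]
            by_cases h1 : 1 < s * ‖f n‖ ^ (2 - p) <;> by_cases h2 : 1 < s * ‖f k‖ ^ (2 - p) <;>
              simp [h1, h2]
    · refine le_of_eq ?_
      congr 1
      refine tsum_congr fun n => ?_
      simp only [hh]
      split_ifs <;> simp
  have hmeas (n k : Fin d → ℤ) : Measurable fun s : ℝ =>
      ENNReal.ofReal (A / s ^ (p / (2 - p))) *
          (if 1 < s * ‖f n‖ ^ (2 - p) ∧ 1 < s * ‖f k‖ ^ (2 - p) then (1 : ENNReal) else 0) := by
    refine Measurable.mul (by fun_prop) (Measurable.ite ?_ measurable_const measurable_const)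
    exact (measurableSet_lt measurable_const (measurable_id.mul_const _)).inter
      (measurableSet_lt measurable_const (measurable_id.mul_const _))
  have hmeas2 (n : Fin d → ℤ) : Measurable fun s : ℝ =>
      (if 1 < s * ‖f n‖ ^ (2 - p) then (0 : ENNReal) else ‖f n‖ₑ ^ 2) :=
    Measurable.ite (measurableSet_lt (by fun_prop) (by fun_prop)) measurable_const measurable_const
  have hbig : ∫⁻ s in Set.Ioi (0 : ℝ),
      (∑' n, ∑' k, ENNReal.ofReal (A / s ^ (p / (2 - p))) *
          (if 1 < s * ‖f n‖ ^ (2 - p) ∧ 1 < s * ‖f k‖ ^ (2 - p) then 1 else 0)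
            * (‖f n‖ₑ * ‖f k‖ₑ)) ≤ ENNReal.ofReal (A * (2 - p) / (2 * p - 2)) := by
    rw [lintegral_tsum fun n => (Measurable.tsum fun k =>
      (hmeas n k).mul_const _).aemeasurable]
    calc _ ≤ ∑' n, ∑' k, ENNReal.ofReal (A * (2 - p) / (2 * p - 2)) *
            (‖f n‖ₑ ^ p * ‖f k‖ₑ ^ p) := by
          refine ENNReal.tsum_le_tsum fun n => ?_
          rw [lintegral_tsum fun k => ((hmeas n k).mul_const _).aemeasurable]
          refine ENNReal.tsum_le_tsum fun k => ?_
          rw [lintegral_mul_const _ (hmeas n k)]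
          by_cases hn : f n = 0
          · simp [hn]
          by_cases hk : f k = 0
          · simp [hk]
          have hn' := norm_pos_iff.2 hn
          have hk' := norm_pos_iff.2 hk
          refine (mul_le_mul_left (lintegral_threshold_pair_le hA hp hp2 hn' hk') _).trans_eq ?_
          have hq : 0 ≤ A * (2 - p) / (2 * p - 2) :=
            div_nonneg (mul_nonneg hA (by linarith)) (by linarith)
          have e (z : ℂ) (hz : 0 < ‖z‖) : ENNReal.ofReal (‖z‖ ^ (p - 1)) * ‖z‖ₑ = ‖z‖ₑ ^ p := by
            rw [← ENNReal.ofReal_rpow_of_pos hz, ofReal_norm]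
            conv_lhs => rw [← ENNReal.rpow_one ‖z‖ₑ, ← ENNReal.rpow_mul]
            rw [← ENNReal.rpow_add _ _ (by simpa using hz) (by simp)]
            simp
          rw [ENNReal.ofReal_mul hq, ENNReal.ofReal_mul (by positivity), ← e _ hn', ← e _ hk']
          ring
      _ = ENNReal.ofReal (A * (2 - p) / (2 * p - 2)) * ((∑' n, ‖f n‖ₑ ^ p) * ∑' n, ‖f n‖ₑ ^ p) := by
          simp_rw [ENNReal.tsum_mul_left, ENNReal.tsum_mul_right]
      _ ≤ ENNReal.ofReal (A * (2 - p) / (2 * p - 2)) * (1 * 1) := by gcongr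
      _ = _ := by simp
  have hsmall : ∫⁻ s in Set.Ioi (0 : ℝ),
      ∑' n, (if 1 < s * ‖f n‖ ^ (2 - p) then 0 else ‖f n‖ₑ ^ 2) ≤ 1 := by
    rw [lintegral_tsum fun n => (hmeas2 n).aemeasurable]
    refine (ENNReal.tsum_le_tsum fun n => ?_).trans hf1
    by_cases hn : f n = 0
    · simp [hn]
    · simpa [ofReal_norm] using lintegral_threshold_le (norm_pos_iff.2 hn)
  rw [hlayer]
  refine (setLIntegral_mono' measurableSet_Ioi hlevel).trans ?_
  rw [lintegral_add_right _ ((Measurable.tsum hmeas2).const_mul 2),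
    lintegral_const_mul _ (Measurable.tsum hmeas2), lintegral_const_mul _
      (Measurable.tsum fun n => Measurable.tsum fun k => (hmeas n k).mul_const _)]
  calc _ ≤ 2 * ENNReal.ofReal (A * (2 - p) / (2 * p - 2)) + 2 * 1 := by gcongr
    _ = _ := by simp

end WeightedEstimate

section Multiplier

variable {d : ℕ}

/-- Weighted `ℓ^p → L²` estimate for the Fourier transform with a weak-type weight. -/
lemma exists_lintegral_weight_enorm_dft_sq_le {u : (Fin d → ℝ) → ℝ} (hu : Measurable u)
    (hu0 : ∀ ξ, 0 ≤ u ξ) {p A : ℝ} (hp : 1 < p) (hp2 : p < 2) (hA : 0 ≤ A)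
    (hweak : ∀ s : ℝ, 0 < s →
      volume {ξ ∈ unitCube d | s ≤ u ξ} ≤ ENNReal.ofReal (A / s ^ (p / (2 - p)))) :
    ∃ K : ENNReal, K ≠ ⊤ ∧ ∀ f : (Fin d → ℤ) → ℂ, Summable (fun n => ‖f n‖) →
      ∫⁻ ξ in unitCube d, ENNReal.ofReal (u ξ) * ‖dft d f ξ‖ₑ ^ 2
        ≤ K * (∑' n, ‖f n‖ₑ ^ p) ^ (2 / p) := by
  have hp0 : 0 < p := by linarith
  refine ⟨2 * ENNReal.ofReal (A * (2 - p) / (2 * p - 2)) + 2, by finiteness, fun f hf => ?_⟩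
  set K := 2 * ENNReal.ofReal (A * (2 - p) / (2 * p - 2)) + 2
  set N := ∑' n, ‖f n‖ₑ ^ p with hN
  have hK : K ≠ 0 := by simp [K]
  by_cases hN0 : N = 0
  · have hz : ∀ n, f n = 0 := fun n => by
      have := ENNReal.tsum_eq_zero.1 (hN ▸ hN0) n
      simpa [ENNReal.rpow_eq_zero_iff_of_pos hp0] using this
    simp [dft, hz]
  by_cases hNt : N = ⊤
  · rw [hNt, ENNReal.top_rpow_of_pos (by positivity), ENNReal.mul_top hK]
    exact le_top
  set r : ℝ := N.toReal ^ (1 / p) with hr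
  have hN' : 0 < N.toReal := ENNReal.toReal_pos hN0 hNt
  have hr0 : 0 < r := by positivity
  have hrN : ENNReal.ofReal r = N ^ (1 / p) := by
    rw [hr, ← ENNReal.ofReal_rpow_of_pos hN', ENNReal.ofReal_toReal hNt]
  set g : (Fin d → ℤ) → ℂ := fun n => ((r⁻¹ : ℝ) : ℂ) * f n with hg
  have hfg : f = fun n => (r : ℂ) * g n := by
    ext n
    have : (r : ℂ) ≠ 0 := by exact_mod_cast hr0.ne'
    simp [hg, this]
  have hre : ‖(r : ℂ)‖ₑ = N ^ (1 / p) := by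
    rw [← ofReal_norm, Complex.norm_of_nonneg hr0.le, hrN]
  have hgs : Summable fun n => ‖g n‖ := by
    simpa [hg] using hf.mul_left |r⁻¹|
  have hg1 : ∑' n, ‖g n‖ₑ ^ p ≤ 1 := by
    have h : N = N * ∑' n, ‖g n‖ₑ ^ p := by
      rw [← ENNReal.tsum_mul_left]
      conv_lhs => rw [hN, hfg]
      refine tsum_congr fun n => ?_
      rw [enorm_mul, ENNReal.mul_rpow_of_nonneg _ _ hp0.le, hre, ← ENNReal.rpow_mul,
        one_div_mul_cancel hp0.ne', ENNReal.rpow_one]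
    refine le_of_eq ((ENNReal.mul_right_inj hN0 hNt).1 ?_)
    rw [← h, mul_one]
  have key := lintegral_weight_enorm_dft_sq_le_of_tsum_le_one hu hu0 hp hp2 hA hweak hgs hg1
  calc ∫⁻ ξ in unitCube d, ENNReal.ofReal (u ξ) * ‖dft d f ξ‖ₑ ^ 2
      = ∫⁻ ξ in unitCube d, N ^ (2 / p) * (ENNReal.ofReal (u ξ) * ‖dft d g ξ‖ₑ ^ 2) := by
        refine lintegral_congr fun ξ => ?_
        conv_lhs => rw [hfg, dft_const_mul, enorm_mul, mul_pow, hre]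
        rw [← ENNReal.rpow_natCast (N ^ (1 / p)), ← ENNReal.rpow_mul,
          show 1 / p * ((2 : ℕ) : ℝ) = 2 / p by push_cast; ring]
        ring
    _ = N ^ (2 / p) * ∫⁻ ξ in unitCube d, ENNReal.ofReal (u ξ) * ‖dft d g ξ‖ₑ ^ 2 := by
        rw [lintegral_const_mul _ (by
          have := (continuous_dft hgs).measurable
          fun_prop)]
    _ ≤ N ^ (2 / p) * K := by gcongr
    _ = _ := mul_comm _ _

/-- If `m ∈ L^{α,∞}`, then `f ↦ |m|^{α(1/p - 1/2)} F(f)` is bounded from `ℓ^p` to `L²`. -/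
lemma exists_lintegral_rpow_enorm_dft_sq_le {m : (Fin d → ℝ) → ℂ} (hm : Measurable m)
    {α c p : ℝ} (hα : 0 < α) (hc : 0 ≤ c) (hp : 1 < p) (hp2 : p ≤ 2)
    (hweak : ∀ s : ℝ, 0 < s →
      volume {ξ ∈ unitCube d | s ≤ ‖m ξ‖} ≤ ENNReal.ofReal (c / s ^ α)) :
    ∃ K : ENNReal, K ≠ ⊤ ∧ ∀ f : (Fin d → ℤ) → ℂ, Summable (fun n => ‖f n‖) →
      (∫⁻ ξ in unitCube d, (‖m ξ‖ₑ ^ (α * (1 / p - 1 / 2)) * ‖dft d f ξ‖ₑ) ^ (2 : ℝ)) ^ (1 / 2 : ℝ)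
        ≤ K * (∑' n, ‖f n‖ₑ ^ p) ^ (1 / p) := by
  have hp0 : 0 < p := by linarith
  rcases hp2.eq_or_lt with rfl | hp2
  · refine ⟨1, by simp, fun f hf => le_of_eq ?_⟩
    simp [lintegral_enorm_dft_sq hf]
  have h2p : 0 < 2 - p := by linarith
  set e : ℝ := α * (2 / p - 1) with he
  have he0 : 0 < e := by
    have : 1 < 2 / p := by rw [lt_div_iff₀ hp0]; linarith
    exact mul_pos hα (by linarith)
  obtain ⟨K, hK, h⟩ := exists_lintegral_weight_enorm_dft_sq_le (u := fun ξ => ‖m ξ‖ ^ e)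
    (by fun_prop) (fun ξ => by positivity) hp hp2 hc (fun s hs => by
      convert hweak (s ^ (1 / e)) (by positivity) using 3
      · ext ξ
        rw [and_congr_right_iff]
        intro _
        rw [one_div, Real.rpow_inv_le_iff_of_pos hs.le (norm_nonneg _) he0]
      · rw [← Real.rpow_mul hs.le]
        congr 2
        rw [he]
        field_simp)
  refine ⟨K ^ (1 / 2 : ℝ), by finiteness, fun f hf => ?_⟩
  have h1 := ENNReal.rpow_le_rpow (h f hf) (z := 1 / 2) (by norm_num)
  rw [ENNReal.mul_rpow_of_nonneg _ _ (by norm_num), ← ENNReal.rpow_mul (∑' n, ‖f n‖ₑ ^ p),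
    show 2 / p * (1 / 2) = 1 / p by ring] at h1
  convert h1 using 4 with ξ
  rw [ENNReal.mul_rpow_of_nonneg _ _ (by norm_num), ← ENNReal.rpow_mul,
    ← ENNReal.ofReal_rpow_of_nonneg (norm_nonneg _) he0.le, ofReal_norm, ENNReal.rpow_two,
    show α * (1 / p - 1 / 2) * 2 = e by rw [he]; ring]

/-- A weak-type bound on the unit cube persists for smaller exponents. -/
lemma weak_bound_of_exponent_le {v : (Fin d → ℝ) → ℝ} {α β c : ℝ} (hβ : 0 < β) (hβα : β ≤ α)
    (hweak : ∀ s : ℝ, 0 < s →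
      volume {ξ ∈ unitCube d | s ≤ v ξ} ≤ ENNReal.ofReal (c / s ^ α)) (s : ℝ) (hs : 0 < s) :
    volume {ξ ∈ unitCube d | s ≤ v ξ} ≤ ENNReal.ofReal (max 1 c / s ^ β) := by
  rcases le_total 1 s with h1 | h1
  · refine (hweak s hs).trans (ENNReal.ofReal_le_ofReal ?_)
    gcongr
    · exact le_max_right _ _
  · have hvol : volume (unitCube d) = 1 := by
      rw [← Measure.restrict_apply_univ, measure_univ]
    calc volume {ξ ∈ unitCube d | s ≤ v ξ} ≤ volume (unitCube d) := measure_mono fun ξ h => h.1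
      _ = ENNReal.ofReal 1 := by rw [hvol, ENNReal.ofReal_one]
      _ ≤ _ := by
        refine ENNReal.ofReal_le_ofReal ?_
        rw [one_le_div (by positivity)]
        exact (Real.rpow_le_one hs.le h1 hβ.le).trans (le_max_left _ _)

/-- Bilinear form of the multiplier estimate. -/
lemma exists_lintegral_enorm_mul_dft_mul_dft_le {m : (Fin d → ℝ) → ℂ} (hm : Measurable m)
    {α c p q' : ℝ} (hα : 0 < α) (hc : 0 ≤ c) (hp : 1 < p) (hp2 : p ≤ 2) (hq : 1 < q')
    (hq2 : q' ≤ 2) (hpq : α * (1 / p + 1 / q' - 1) = 1)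
    (hweak : ∀ s : ℝ, 0 < s →
      volume {ξ ∈ unitCube d | s ≤ ‖m ξ‖} ≤ ENNReal.ofReal (c / s ^ α)) :
    ∃ K : ENNReal, K ≠ ⊤ ∧ ∀ f h : (Fin d → ℤ) → ℂ, Summable (fun n => ‖f n‖) →
      Summable (fun n => ‖h n‖) →
      ∫⁻ ξ in unitCube d, ‖m ξ * dft d f ξ * starRingEnd ℂ (dft d h ξ)‖ₑ
        ≤ K * (∑' n, ‖f n‖ₑ ^ p) ^ (1 / p) * (∑' n, ‖h n‖ₑ ^ q') ^ (1 / q') := by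
  obtain ⟨K₁, hK₁, h₁⟩ := exists_lintegral_rpow_enorm_dft_sq_le hm hα hc hp hp2 hweak
  obtain ⟨K₂, hK₂, h₂⟩ := exists_lintegral_rpow_enorm_dft_sq_le hm hα hc hq hq2 hweak
  refine ⟨K₁ * K₂, ENNReal.mul_ne_top hK₁ hK₂, fun f h hf hh => ?_⟩
  have hle (r : ℝ) (hr : 1 < r) (hr2 : r ≤ 2) : 0 ≤ α * (1 / r - 1 / 2) :=
    mul_nonneg hα.le (sub_nonneg.2 (one_div_le_one_div_of_le (by linarith) hr2))
  have hfm := (continuous_dft hf).measurable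
  have hhm := (continuous_dft hh).measurable
  calc _ = ∫⁻ ξ in unitCube d, ((fun ξ => ‖m ξ‖ₑ ^ (α * (1 / p - 1 / 2)) * ‖dft d f ξ‖ₑ) *
          fun ξ => ‖m ξ‖ₑ ^ (α * (1 / q' - 1 / 2)) * ‖dft d h ξ‖ₑ) ξ := by
        refine lintegral_congr fun ξ => ?_
        have : ‖m ξ‖ₑ = ‖m ξ‖ₑ ^ (α * (1 / p - 1 / 2)) * ‖m ξ‖ₑ ^ (α * (1 / q' - 1 / 2)) := by
          rw [← ENNReal.rpow_add_of_nonneg _ _ (hle p hp hp2) (hle q' hq hq2),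
            show α * (1 / p - 1 / 2) + α * (1 / q' - 1 / 2) = 1 by linear_combination hpq,
            ENNReal.rpow_one]
        rw [enorm_mul, enorm_mul, RCLike.enorm_conj, Pi.mul_apply]
        conv_lhs => rw [this]
        ring
    _ ≤ _ := ENNReal.lintegral_mul_le_Lp_mul_Lq _ Real.HolderConjugate.two_two
        (by fun_prop) (by fun_prop)
    _ ≤ (K₁ * (∑' n, ‖f n‖ₑ ^ p) ^ (1 / p)) * (K₂ * (∑' n, ‖h n‖ₑ ^ q') ^ (1 / q')) :=
        mul_le_mul' (h₁ f hf) (h₂ h hh)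
    _ = _ := by ring

lemma dft_single (n : Fin d → ℤ) (ξ : Fin d → ℝ) :
    dft d (Pi.single n 1) ξ = expChar n ξ := by
  rw [dft_eq_tsum_expChar, tsum_eq_single n (fun k hk => by simp [hk])]
  simp

lemma Tmult_eq (m : (Fin d → ℝ) → ℂ) (f : (Fin d → ℤ) → ℂ) (n : Fin d → ℤ) :
    Tmult d m f n = ∫ ξ in unitCube d, m ξ * dft d f ξ * starRingEnd ℂ (expChar n ξ) := by
  simp_rw [star_expChar]
  rfl

/-- Duality pairing of `T_m f` with a finitely supported sequence. -/
lemma sum_Tmult_mul_conj {m : (Fin d → ℝ) → ℂ} {f h : (Fin d → ℤ) → ℂ} (S : Finset (Fin d → ℤ))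
    (hS : ∀ n ∉ S, h n = 0) (hInt : ∀ n, Integrable
      (fun ξ => m ξ * dft d f ξ * starRingEnd ℂ (expChar n ξ)) (volume.restrict (unitCube d))) :
    ∑ n ∈ S, Tmult d m f n * starRingEnd ℂ (h n)
      = ∫ ξ in unitCube d, m ξ * dft d f ξ * starRingEnd ℂ (dft d h ξ) := by
  simp_rw [Tmult_eq, ← integral_mul_const]
  rw [← integral_finsetSum _ fun n _ => (hInt n).mul_const _]
  congr 1 with ξ
  rw [dft_eq_tsum_expChar h, tsum_eq_sum (s := S) fun n hn => by simp [hS n hn], map_sum,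
    Finset.mul_sum]
  refine Finset.sum_congr rfl fun n _ => ?_
  rw [map_mul]
  ring

lemma lpNorm_eq (f : (Fin d → ℤ) → ℂ) {p : ℝ} (hp : 0 < p) :
    lpNorm d f p = (∑' n, ‖f n‖ₑ ^ p) ^ (1 / p) := by
  unfold _root_.lpNorm
  rw [eLpNorm_eq_lintegral_rpow_enorm_toReal (by simpa using hp) (by simp),
    lintegral_count, ENNReal.toReal_ofReal hp.le]

lemma tsum_enorm_rpow_ne_top {f : (Fin d → ℤ) → ℂ} (hf : Summable fun n => ‖f n‖) {p : ℝ}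
    (hp : 1 ≤ p) : ∑' n, ‖f n‖ₑ ^ p ≠ ⊤ := by
  have hT : ∑' n, ‖f n‖ₑ ≠ ⊤ := by
    simpa [ofReal_norm] using hf.tsum_ofReal_ne_top
  refine ne_top_of_le_ne_top (b := (∑' n, ‖f n‖ₑ) ^ (p - 1) * ∑' n, ‖f n‖ₑ) ?_ ?_
  · have : 0 ≤ p - 1 := by linarith
    finiteness
  · rw [← ENNReal.tsum_mul_left]
    refine ENNReal.tsum_le_tsum fun n => ?_
    calc ‖f n‖ₑ ^ p = ‖f n‖ₑ ^ (p - 1) * ‖f n‖ₑ := by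
          conv_rhs => enter [2]; rw [← ENNReal.rpow_one ‖f n‖ₑ]
          rw [← ENNReal.rpow_add_of_nonneg _ _ (by linarith) zero_le_one, sub_add_cancel]
      _ ≤ _ := by
          gcongr
          exact ENNReal.le_tsum n

/-- The converse of Hölder's inequality for a finite sum tested on its extremiser. -/
lemma ENNReal.le_rpow_of_le_mul_rpow {X B : ENNReal} {q q' : ℝ} (hq : q.HolderConjugate q')
    (hX : X ≠ ⊤) (h : X ≤ B * X ^ (1 / q')) : X ≤ B ^ q := by
  rcases eq_or_ne X 0 with rfl | hX0
  · exact zero_le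
  have hs : X = X ^ (1 / q) * X ^ (1 / q') := by
    rw [← ENNReal.rpow_add _ _ hX0 hX, one_div, one_div, hq.inv_add_inv_eq_one, ENNReal.rpow_one]
  have hne : X ^ (1 / q') ≠ 0 := by simp [hX0, hX]
  have hnt : X ^ (1 / q') ≠ ⊤ := by simp [hX0, hX]
  have h2 : X ^ (1 / q) ≤ B := by
    conv_lhs at h => rw [hs]
    exact (ENNReal.mul_le_mul_iff_left hne hnt).1 h
  rwa [one_div, ENNReal.rpow_inv_le_iff hq.pos] at h2

end Multiplier

/-- If `m ∈ L^{α,∞}(𝕋^d)` with `α > 1`, then `T_m` is bounded from `ℓ^p(ℤ^d)` to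
`ℓ^q(ℤ^d)` for every pair `(p,q)` with `1 < p ≤ 2 ≤ q < ∞` and `1/p − 1/q ≥ 1/α`. -/
theorem stmt_6 (d : ℕ) (m : (Fin d → ℝ) → ℂ) (hm : Measurable m)
    (α : ℝ) (hα : 1 < α) (c : ℝ) (hc : 0 < c)
    (hweak : ∀ s : ℝ, 0 < s →
      volume {ξ ∈ unitCube d | s ≤ ‖m ξ‖} ≤ ENNReal.ofReal (c / s ^ α))
    (p q : ℝ) (hp : 1 < p) (hp2 : p ≤ 2) (h2q : 2 ≤ q)
    (hpq : 1 / α ≤ 1 / p - 1 / q) :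
    ∃ C : ℝ, 0 < C ∧ ∀ f : (Fin d → ℤ) → ℂ, Summable (fun n => ‖f n‖) →
      lpNorm d (Tmult d m f) q ≤ ENNReal.ofReal C * lpNorm d f p := by
  have hp0 : 0 < p := by linarith
  have hq0 : 0 < q := by linarith
  have hq1 : 1 < q := by linarith
  set δ : ℝ := 1 / p - 1 / q with hδ
  have hδ0 : 0 < δ := lt_of_lt_of_le (by positivity) hpq
  set q' : ℝ := q.conjExponent with hq'
  have hconj : q.HolderConjugate q' := Real.HolderConjugate.conjExponent hq1
  have hinv : 1 / q' = 1 - 1 / q := by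
    have := hconj.inv_add_inv_eq_one
    simp only [one_div]
    linarith
  have hq'1 : 1 < q' := hconj.symm.lt
  have hq'2 : q' ≤ 2 := by
    have h1 : 1 / q ≤ 1 / 2 := one_div_le_one_div_of_le (by norm_num) h2q
    have h2 : 1 / 2 ≤ 1 / q' := by linarith
    exact (one_div_le_one_div (by norm_num) hconj.symm.pos).1 h2
  have hβα : 1 / δ ≤ α := by
    rw [div_le_iff₀ hδ0]
    rwa [div_le_iff₀ (by linarith), mul_comm] at hpq
  obtain ⟨K, hK, hbil⟩ := exists_lintegral_enorm_mul_dft_mul_dft_le hm (α := 1 / δ)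
    (by positivity) (c := max 1 c) (by positivity) hp hp2 hq'1 hq'2
    (by rw [hinv, show 1 / p + (1 - 1 / q) - 1 = δ by rw [hδ]; ring]; field_simp)
    (weak_bound_of_exponent_le (by positivity) hβα hweak)
  refine ⟨K.toReal + 1, by positivity, fun f hf => ?_⟩
  have hKle : K ≤ ENNReal.ofReal (K.toReal + 1) := by
    conv_lhs => rw [← ENNReal.ofReal_toReal hK]
    exact ENNReal.ofReal_le_ofReal (by linarith)
  rw [lpNorm_eq _ hp0, lpNorm_eq _ hq0]
  refine le_trans ?_ (mul_le_mul_left hKle _)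
  set B := K * (∑' n, ‖f n‖ₑ ^ p) ^ (1 / p) with hB
  have hPt : ∑' n, ‖f n‖ₑ ^ p ≠ ⊤ := tsum_enorm_rpow_ne_top hf hp.le
  have hInt (n : Fin d → ℤ) : Integrable
      (fun ξ => m ξ * dft d f ξ * starRingEnd ℂ (expChar n ξ)) (volume.restrict (unitCube d)) := by
    have hsing : Summable fun k => ‖(Pi.single n 1 : (Fin d → ℤ) → ℂ) k‖ :=
      summable_of_ne_finset_zero (s := {n}) fun k hk => by
        simp [Pi.single_eq_of_ne (Finset.notMem_singleton.1 hk)]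
    have h1 := hbil f (Pi.single n 1) hf hsing
    simp_rw [dft_single] at h1
    have hfm := (continuous_dft hf).measurable
    have hem := (continuous_expChar n).measurable
    refine ⟨Measurable.aestronglyMeasurable ?_, h1.trans_lt ?_⟩
    · exact (hm.mul hfm).mul (Complex.continuous_conj.measurable.comp hem)
    · have h2 := tsum_enorm_rpow_ne_top hsing hq'1.le
      have h3 := hconj.symm.pos
      finiteness
  rw [one_div q, ENNReal.rpow_inv_le_iff hq0, ENNReal.tsum_eq_iSup_sum]
  refine iSup_le fun S => ?_
  have hXt : ∑ n ∈ S, ‖Tmult d m f n‖ₑ ^ q ≠ ⊤ :=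
    ENNReal.sum_ne_top.2 fun n _ => by finiteness
  refine ENNReal.le_rpow_of_le_mul_rpow hconj hXt ?_
  classical
  set h : (Fin d → ℤ) → ℂ := fun n =>
    if n ∈ S then ((‖Tmult d m f n‖ ^ (q - 2) : ℝ) : ℂ) * Tmult d m f n else 0 with hh
  have hS : ∀ n ∉ S, h n = 0 := fun n hn => by simp [hh, hn]
  have hhs : Summable fun n => ‖h n‖ :=
    summable_of_ne_finset_zero (s := S) fun n hn => by simp [hS n hn]
  have hpow (z : ℂ) : ‖z‖ ^ (q - 2) * ‖z‖ * ‖z‖ = ‖z‖ ^ q := by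
    rcases eq_or_ne z 0 with rfl | hz
    · simp [hq0.ne']
    · have hz' := norm_pos_iff.2 hz
      rw [mul_assoc, ← pow_two, ← Real.rpow_natCast, ← Real.rpow_add hz']
      congr 1
      push_cast
      ring
  have hpow' (z : ℂ) : (‖z‖ ^ (q - 2) * ‖z‖) ^ q' = ‖z‖ ^ q := by
    rcases eq_or_ne z 0 with rfl | hz
    · simp [hq0.ne', hconj.symm.pos.ne']
    · have hz' := norm_pos_iff.2 hz
      rw [← Real.rpow_add_one hz'.ne', ← Real.rpow_mul hz'.le]
      congr 1
      have := hconj.sub_one_mul_conj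
      linarith
  have hsum : ∑' n, ‖h n‖ₑ ^ q' = ∑ n ∈ S, ‖Tmult d m f n‖ₑ ^ q := by
    rw [tsum_eq_sum (s := S) fun n hn => by simp [hS n hn, hconj.symm.pos]]
    refine Finset.sum_congr rfl fun n hn => ?_
    rw [← ofReal_norm, ← ofReal_norm, ENNReal.ofReal_rpow_of_nonneg (norm_nonneg _) hq0.le,
      ENNReal.ofReal_rpow_of_nonneg (norm_nonneg _) hconj.symm.nonneg, ← hpow']
    simp only [hh, hn, if_true, norm_mul, Complex.norm_real, Real.norm_eq_abs]
    rw [abs_of_nonneg (by positivity)]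
  have hpair : ∑ n ∈ S, ‖Tmult d m f n‖ₑ ^ q
      = ‖∑ n ∈ S, Tmult d m f n * starRingEnd ℂ (h n)‖ₑ := by
    have : ∑ n ∈ S, Tmult d m f n * starRingEnd ℂ (h n)
        = ((∑ n ∈ S, ‖Tmult d m f n‖ ^ q : ℝ) : ℂ) := by
      rw [Complex.ofReal_sum]
      refine Finset.sum_congr rfl fun n hn => ?_
      simp only [hh, hn, if_true, map_mul, Complex.conj_ofReal]
      rw [← hpow, mul_left_comm, Complex.mul_conj']
      push_cast
      ring
    rw [this, ← ofReal_norm, Complex.norm_of_nonneg (by positivity),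
      ENNReal.ofReal_sum_of_nonneg fun _ _ => by positivity]
    refine Finset.sum_congr rfl fun n _ => ?_
    rw [← ofReal_norm, ENNReal.ofReal_rpow_of_nonneg (norm_nonneg _) hq0.le]
  rw [hpair, sum_Tmult_mul_conj S hS hInt]
  refine (enorm_integral_le_lintegral_enorm _).trans ((hbil f h hf hhs).trans_eq ?_)
  rw [hsum, hpair, sum_Tmult_mul_conj S hS hInt]
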